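/- Let d ≥ 2, s ≥ 1, and let E ⊆ ℝ^d be a measurable set of finite Lebesgue measure and finite perimeter. Then ω_{d−1}·Per(E) ≤ liminf_{r→0⁺} J̃_r^s(E)/σ^s(r) ≤ limsup_{r→0⁺} J̃_r^s(E)/σ^s(r) ≤ M(s,d)·Per(E), where M(1,d) = d·ω_d/2 and M(s,d) = ω_{d−1} for s > 1; in particular, for s > 1, lim_{r→0⁺} J̃_r^s(E)/σ^s(r) = ω_{d−1}·Per(E). -/

import Mathlib

open MeasureTheory Filter Set Metric
open scoped ENNReal NNReal symmDiff

noncomputable section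

abbrev Euc (d : ℕ) : Type := EuclideanSpace ℝ (Fin d)

/-- The kernel `k^s_r`. -/
def ker (d : ℕ) (s r t : ℝ) : ℝ :=
  if t ≤ r then r ^ (-((d : ℝ) + s)) else t ^ (-((d : ℝ) + s))

/-- The regularized `s`-fractional perimeter `J̃_r^s(E) = ∫_E ∫_{Eᶜ} k^s_r(|x-y|) dy dx`. -/
def Jt (d : ℕ) (s r : ℝ) (E : Set (Euc d)) : ℝ≥0∞ :=
  ∫⁻ x in E, ∫⁻ y in Eᶜ, ENNReal.ofReal (ker d s r (dist x y))

/-- The scaling factor `σ^s(r)`. -/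
def sgm (d : ℕ) (s r : ℝ) : ℝ :=
  if s = 1 then |Real.log r| else (((d : ℝ) + s) / ((d : ℝ) + 1)) * r ^ (1 - s) / (s - 1)

/-- The scaling factor `β(r,s)` for the simultaneous limit. -/
def betaScale (d : ℕ) (s r : ℝ) : ℝ :=
  (((d : ℝ) + s) / ((d : ℝ) + 1)) * ((r ^ (1 - s) - 1) / (s - 1)) + 1 / ((d : ℝ) + 1)

/-- `ω_k`: Lebesgue measure of the unit ball in `ℝ^k`. -/
def omegaB (k : ℕ) : ℝ := (volume (ball (0 : Euc k) 1)).toReal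

/-- Divergence of a vector field on `ℝ^d`. -/
def diverg {d : ℕ} (Φ : Euc d → Euc d) (x : Euc d) : ℝ :=
  ∑ i : Fin d, fderiv ℝ Φ x (EuclideanSpace.single i 1) i

/-- De Giorgi perimeter. -/
def Per (d : ℕ) (E : Set (Euc d)) : ℝ≥0∞ :=
  ⨆ (Φ : Euc d → Euc d) (_ : ContDiff ℝ 1 Φ) (_ : HasCompactSupport Φ)
    (_ : ∀ x, ‖Φ x‖ ≤ 1), ENNReal.ofReal (∫ x in E, diverg Φ x)

/-- The cube `lQ + ξ` where `Q = [-1/2, 1/2)^d`. -/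
def cube (d : ℕ) (l : ℝ) (ξ : Euc d) : Set (Euc d) :=
  {x | ∀ i, x i ∈ Set.Ico (ξ i - l / 2) (ξ i + l / 2)}

/-- Half space `H⁻_ν(0)`. -/
def Hminus (d : ℕ) (ν : Euc d) : Set (Euc d) := {y | @inner ℝ _ _ ν y ≤ 0}

/-- Standard (normalized) `k`-dimensional Hausdorff measure on `ℝ^d`:
Mathlib's `μH[k]` uses `diam^k` gauges without the normalizing constant `ω_k/2^k`. -/
def Hstd (d : ℕ) (k : ℕ) : Measure (Euc d) :=
  (ENNReal.ofReal (omegaB k / 2 ^ k)) • (μH[(k : ℝ)] : Measure (Euc d))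

/-- The nonlocal `k^s_r`-curvature. -/
def curv (d : ℕ) (s r : ℝ) (E : Set (Euc d)) (x : Euc d) : ℝ :=
  ∫ y, (Set.indicator Eᶜ (fun _ => (1 : ℝ)) y - Set.indicator E (fun _ => (1 : ℝ)) y)
    * ker d s r (dist x y)

/-- The class `𝔈`: closures of open sets with compact `C²` boundary. -/
def IsC2Domain (d : ℕ) (E : Set (Euc d)) : Prop :=
  ∃ U : Set (Euc d), IsOpen U ∧ E = closure U ∧ IsCompact (frontier U) ∧
    ∃ f : Euc d → ℝ, ContDiff ℝ 2 f ∧ U = {x | f x < 0} ∧ frontier U = {x | f x = 0} ∧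
      ∀ x ∈ frontier U, fderiv ℝ f x ≠ 0

lemma radial {d : ℕ} (hd : 1 ≤ d) (w : Euc d → ℝ≥0∞) (hw : Measurable w)
    (hom : ∀ t : ℝ, 0 < t → ∀ x, w (t • x) = ENNReal.ofReal t * w x)
    (f : ℝ → ℝ≥0∞) (hf : Measurable f) :
    ∫⁻ h, f ‖h‖ * w h = (∫⁻ θ, w θ.1 ∂((volume : Measure (Euc d)).toSphere)) *
      ∫⁻ t in Ioi (0:ℝ), f t * ENNReal.ofReal (t ^ d) := by
  have : Nonempty (Fin d) := ⟨⟨0, hd⟩⟩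
  have hmp := (volume : Measure (Euc d)).measurePreserving_homeomorphUnitSphereProd
  have hdim : Module.finrank ℝ (Euc d) - 1 = d - 1 := by simp
  rw [hdim] at hmp
  calc ∫⁻ h, f ‖h‖ * w h = ∫⁻ h in ({0}ᶜ : Set (Euc d)), f ‖h‖ * w h := by
        rw [restrict_compl_singleton]
    _ = ∫⁻ x : ({0}ᶜ : Set (Euc d)), f ‖x.1‖ * w x.1 ∂((volume : Measure (Euc d)).comap Subtype.val) := by
        rw [lintegral_subtype_comap (measurableSet_singleton _).compl (fun h => f ‖h‖ * w h)]
    _ = ∫⁻ x : ({0}ᶜ : Set (Euc d)), (fun p : sphere (0 : Euc d) 1 × Ioi (0:ℝ) =>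
          w p.1.1 * (f p.2.1 * ENNReal.ofReal p.2.1)) (homeomorphUnitSphereProd (Euc d) x)
            ∂((volume : Measure (Euc d)).comap Subtype.val) := by
        refine lintegral_congr fun x => ?_
        have hx : x.1 ≠ 0 := x.2
        have hx' : 0 < ‖x.1‖ := norm_pos_iff.2 hx
        simp only [homeomorphUnitSphereProd_apply_snd_coe, homeomorphUnitSphereProd_apply_fst_coe]
        have := hom ‖x.1‖ hx' (‖x.1‖⁻¹ • x.1)
        rw [smul_inv_smul₀ hx'.ne'] at this
        rw [this]; ring
    _ = ∫⁻ p, w p.1.1 * (f p.2.1 * ENNReal.ofReal p.2.1)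
          ∂((volume : Measure (Euc d)).toSphere.prod (Measure.volumeIoiPow (d - 1))) := by
        rw [hmp.lintegral_comp (f := fun p : sphere (0 : Euc d) 1 × Ioi (0:ℝ) =>
          w p.1.1 * (f p.2.1 * ENNReal.ofReal p.2.1))]
        fun_prop
    _ = _ := by
        rw [lintegral_prod_mul (f := fun θ : sphere (0 : Euc d) 1 => w θ.1)
          (g := fun t : Ioi (0:ℝ) => f t.1 * ENNReal.ofReal t.1) (by fun_prop) (by fun_prop)]
        congr 1
        rw [Measure.volumeIoiPow, lintegral_withDensity_eq_lintegral_mul _ (by fun_prop) (by fun_prop),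
          ← lintegral_subtype_comap measurableSet_Ioi (fun t => f t * ENNReal.ofReal (t ^ d))]
        refine lintegral_congr fun t => ?_
        have ht : 0 < t.1 := t.2
        obtain ⟨k, rfl⟩ : ∃ k, d = k + 1 := ⟨d - 1, by omega⟩
        simp only [Pi.mul_apply, Nat.add_sub_cancel]
        rw [pow_succ, ENNReal.ofReal_mul (by positivity)]
        ring

lemma gauss1 : ∫ x : ℝ, |x| * Real.exp (-x ^ 2) = 1 := by
  have h := integral_comp_abs (f := fun x : ℝ => x * Real.exp (-x ^ 2))
  simp only [sq_abs] at h
  rw [h]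
  have := integral_rpow_mul_exp_neg_rpow (p := 2) (q := 1) (by norm_num) (by norm_num)
  simp only [Real.rpow_one, Real.rpow_two] at this
  rw [this]; norm_num

lemma gaussd {d : ℕ} (i0 : Fin d) :
    ∫⁻ h : Euc d, ENNReal.ofReal (Real.exp (-‖h‖ ^ 2)) * ‖h i0‖ₑ =
      ENNReal.ofReal (√Real.pi ^ (d - 1)) := by
  let f : Fin d → ℝ → ℝ := fun i x => if i = i0 then |x| * Real.exp (-x ^ 2) else Real.exp (-x ^ 2)
  have hfi : ∀ i, Integrable (f i) := by
    intro i
    by_cases h : i = i0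
    · simp only [f, h, if_true]
      by_contra hc
      have := integral_undef hc
      rw [gauss1] at this; norm_num at this
    · simp only [f, h, if_false]
      simpa using integrable_exp_neg_mul_sq (b := 1) one_pos
  have hI : Integrable (fun x : Fin d → ℝ => ∏ i, f i (x i)) := Integrable.fintype_prod hfi
  have hp : ∫ x : Fin d → ℝ, ∏ i, f i (x i) = √Real.pi ^ (d - 1) := by
    rw [integral_fintype_prod_volume_eq_prod]
    have : ∀ i, ∫ x, f i x = if i = i0 then 1 else √Real.pi := by
      intro i
      by_cases h : i = i0
      · simp only [f, h, if_true, gauss1]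
      · simp only [f, h, if_false]
        simpa using integral_gaussian 1
    simp only [this]
    rw [Finset.prod_ite]
    simp [Finset.filter_ne']
  have hnn : ∀ x : Fin d → ℝ, 0 ≤ ∏ i, f i (x i) := fun x => Finset.prod_nonneg fun i _ => by
    simp only [f]; split_ifs <;> positivity
  rw [← hp, ofReal_integral_eq_lintegral_ofReal hI (ae_of_all _ hnn),
    ← (PiLp.volume_preserving_toLp (Fin d)).lintegral_comp (by fun_prop)]
  refine lintegral_congr fun x => ?_
  have h1 : ∏ i, f i (x i) = |x i0| * Real.exp (- ∑ i, x i ^ 2) := by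
    rw [← Finset.sum_neg_distrib, Real.exp_sum, ← Finset.mul_prod_erase Finset.univ _ (Finset.mem_univ i0),
      ← Finset.mul_prod_erase Finset.univ (fun i => Real.exp (- x i ^ 2)) (Finset.mem_univ i0), ← mul_assoc]
    congr 1
    · simp [f]
    · refine Finset.prod_congr rfl fun i hi => ?_
      simp [f, (Finset.mem_erase.1 hi).1]
  rw [h1, EuclideanSpace.norm_sq_eq, ENNReal.ofReal_mul (abs_nonneg _), mul_comm]
  simp [← ofReal_norm]

/-- rotation -/
lemma exists_rot {d : ℕ} (i0 : Fin d) (v : Euc d) :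
    ∃ e : Euc d ≃ₗᵢ[ℝ] Euc d, e v = ‖v‖ • EuclideanSpace.single i0 1 := by
  have hn : ‖v‖ = ‖(‖v‖ • EuclideanSpace.single i0 1 : Euc d)‖ := by
    simp [norm_smul]
  refine ⟨(ℝ ∙ (v - ‖v‖ • EuclideanSpace.single i0 1))ᗮ.reflection, ?_⟩
  exact Submodule.reflection_sub hn

lemma gaussv {d : ℕ} (hd : 1 ≤ d) (v : Euc d) :
    ∫⁻ h : Euc d, ENNReal.ofReal (Real.exp (-‖h‖ ^ 2)) * ‖(inner ℝ v h : ℝ)‖ₑ =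
      ‖v‖ₑ * ENNReal.ofReal (√Real.pi ^ (d - 1)) := by
  obtain ⟨e, he⟩ := exists_rot ⟨0, hd⟩ v
  rw [← gaussd ⟨0, hd⟩, ← lintegral_const_mul _ (by fun_prop),
    ← e.measurePreserving.lintegral_comp (f := fun h : Euc d =>
      ‖v‖ₑ * (ENNReal.ofReal (Real.exp (-‖h‖ ^ 2)) * ‖h ⟨0, hd⟩‖ₑ)) (by fun_prop)]
  refine lintegral_congr fun x => ?_
  have : (inner ℝ v x : ℝ) = ‖v‖ * (e x) ⟨0, hd⟩ := by
    rw [← e.inner_map_map, he, inner_smul_left]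
    simp [EuclideanSpace.inner_single_left]
  rw [this, enorm_mul, enorm_norm, e.norm_map]; ring

lemma gaussI (d : ℕ) : ∫⁻ t in Ioi (0:ℝ), ENNReal.ofReal (Real.exp (-t ^ 2)) * ENNReal.ofReal (t ^ d)
    = ENNReal.ofReal (1 / 2 * Real.Gamma (((d:ℝ) + 1) / 2)) := by
  have := integral_rpow_mul_exp_neg_rpow (p := 2) (q := d) (by norm_num) 
    (by have : (0:ℝ) ≤ d := by positivity
        linarith)
  rw [← this, ofReal_integral_eq_lintegral_ofReal]
  · refine setLIntegral_congr_fun measurableSet_Ioi fun t ht => ?_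
    have ht : 0 < t := ht
    simp only [Real.rpow_two, Real.rpow_natCast]
    rw [ENNReal.ofReal_mul (by positivity), mul_comm]
  · by_contra hc
    have h0 := integral_undef hc
    rw [h0] at this
    have : 0 < Real.Gamma (((d:ℝ) + 1) / 2) := Real.Gamma_pos_of_pos (by positivity)
    linarith
  · filter_upwards [self_mem_ae_restrict measurableSet_Ioi] with t ht
    have ht : 0 < t := ht
    simp only [Pi.zero_apply]; positivity

/-- sphere integral -/
lemma sphere_inner {d : ℕ} (hd : 2 ≤ d) (v : Euc d) :
    ∫⁻ θ, ‖(inner ℝ v θ.1 : ℝ)‖ₑ ∂((volume : Measure (Euc d)).toSphere) =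
      ‖v‖ₑ * ENNReal.ofReal (2 * omegaB (d - 1)) := by
  have h1 := gaussv (by omega) v
  rw [radial (by omega) (fun h => ‖(inner ℝ v h : ℝ)‖ₑ) (by fun_prop) (fun t ht x => by
    rw [inner_smul_right, enorm_mul, ← ofReal_norm t, Real.norm_of_nonneg ht.le])
    (fun t => ENNReal.ofReal (Real.exp (-t ^ 2))) (by fun_prop), gaussI] at h1
  have hG : 0 < Real.Gamma (((d:ℝ) + 1) / 2) := Real.Gamma_pos_of_pos (by positivity)
  have hom : omegaB (d - 1) = √Real.pi ^ (d - 1) / Real.Gamma (((d:ℝ) + 1) / 2) := by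
    have : Nonempty (Fin (d - 1)) := ⟨⟨0, by omega⟩⟩
    rw [omegaB, EuclideanSpace.volume_ball]
    simp only [ENNReal.ofReal_one, one_pow, one_mul, Fintype.card_fin]
    have : ((d - 1 : ℕ) : ℝ) / 2 + 1 = (d + 1) / 2 := by
      rw [Nat.cast_sub (by omega)]; push_cast; ring
    rw [this, ENNReal.toReal_ofReal (by positivity)]
  have h2 : ENNReal.ofReal (√Real.pi ^ (d - 1)) = ENNReal.ofReal (2 * omegaB (d - 1)) *
      ENNReal.ofReal (1 / 2 * Real.Gamma (((d:ℝ) + 1) / 2)) := by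
    rw [← ENNReal.ofReal_mul (by rw [hom]; positivity), hom]
    congr 1; field_simp
  rw [h2, ← mul_assoc] at h1
  exact (ENNReal.mul_left_inj (by simp [hG]) ENNReal.ofReal_ne_top).1 h1

/-- radial integral of the directional factor -/
lemma radial_inner {d : ℕ} (hd : 2 ≤ d) (v : Euc d) (f : ℝ → ℝ≥0∞) (hf : Measurable f) :
    ∫⁻ h : Euc d, f ‖h‖ * ‖(inner ℝ v h : ℝ)‖ₑ = ‖v‖ₑ * ENNReal.ofReal (2 * omegaB (d - 1)) *
      ∫⁻ t in Ioi (0:ℝ), f t * ENNReal.ofReal (t ^ d) := by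
  rw [radial (by omega) (fun h => ‖(inner ℝ v h : ℝ)‖ₑ) (by fun_prop) (fun t ht x => by
    rw [inner_smul_right, enorm_mul, ← ofReal_norm t, Real.norm_of_nonneg ht.le]) f hf,
    sphere_inner hd]

lemma radial_norm {d : ℕ} (hd : 2 ≤ d) (f : ℝ → ℝ≥0∞) (hf : Measurable f) :
    ∫⁻ h : Euc d, f ‖h‖ * ‖h‖ₑ = (volume : Measure (Euc d)).toSphere univ *
      ∫⁻ t in Ioi (0:ℝ), f t * ENNReal.ofReal (t ^ d) := by
  rw [radial (by omega) (fun h => ‖h‖ₑ) (by fun_prop) (fun t ht x => by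
    rw [enorm_smul, ← ofReal_norm t, Real.norm_of_nonneg ht.le]) f hf]
  congr 1
  rw [← lintegral_one]
  refine lintegral_congr fun θ => ?_
  rw [← ofReal_norm, norm_eq_of_mem_sphere θ, ENNReal.ofReal_one]

lemma omega_le {d : ℕ} (hd : 2 ≤ d) : omegaB (d - 1) ≤ d * omegaB d / 2 := by
  have i0 : Fin d := ⟨0, by omega⟩
  have h := sphere_inner hd (EuclideanSpace.single i0 1)
  have h2 : ∫⁻ θ, ‖(inner ℝ (EuclideanSpace.single i0 1 : Euc d) θ.1 : ℝ)‖ₑ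
      ∂((volume : Measure (Euc d)).toSphere) ≤ (volume : Measure (Euc d)).toSphere univ := by
    rw [← lintegral_one]
    refine lintegral_mono fun θ => ?_
    rw [← ofReal_norm, ← ENNReal.ofReal_one]
    apply ENNReal.ofReal_le_ofReal
    refine (norm_inner_le_norm _ _).trans ?_
    rw [norm_eq_of_mem_sphere θ]; simp
  rw [h, Measure.toSphere_apply_univ] at h2
  have e1 : ‖(EuclideanSpace.single i0 1 : Euc d)‖ₑ = 1 := by
    rw [← ofReal_norm]; simp
  have e2 : volume (ball (0 : Euc d) 1) = ENNReal.ofReal (omegaB d) := by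
    rw [omegaB, ENNReal.ofReal_toReal measure_ball_lt_top.ne]
  have e3 : 0 ≤ omegaB d := ENNReal.toReal_nonneg
  rw [e1, one_mul, e2, finrank_euclideanSpace, Fintype.card_fin, ← ENNReal.ofReal_natCast,
    ← ENNReal.ofReal_mul (by positivity), ENNReal.ofReal_le_ofReal_iff (by positivity)] at h2
  linarith

lemma ker_meas (d : ℕ) (s r : ℝ) : Measurable (ker d s r) := by
  unfold _root_.ker
  exact Measurable.ite measurableSet_Iic measurable_const (by fun_prop)

/-- the radial kernel weight -/
def Iker (d : ℕ) (s η r : ℝ) : ℝ≥0∞ :=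
  ∫⁻ t in Ioi (0:ℝ), (Iic η).indicator (fun t => ENNReal.ofReal (ker d s r t)) t *
    ENNReal.ofReal (t ^ d)

def cst (d : ℕ) (s η : ℝ) : ℝ := if s = 1 then 1 / ((d:ℝ) + 1) + Real.log η else -(η ^ (1 - s) / (s - 1))

lemma Iker_eq (d : ℕ) (s η r : ℝ) (hs : 1 ≤ s) (hr : 0 < r) (hr1 : r < 1) (hη : r < η) :
    Iker d s η r = ENNReal.ofReal (sgm d s r + cst d s η) := by
  have hη0 : 0 < η := hr.trans hη
  have hsplit : Iker d s η r = (∫⁻ t in Ioc 0 r, ENNReal.ofReal (r ^ (-((d:ℝ) + s)) * t ^ d)) +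
      ∫⁻ t in Ioc r η, ENNReal.ofReal (t ^ (-s)) := by
    have h1 : Iker d s η r = ∫⁻ t in Ioc 0 η, ENNReal.ofReal (ker d s r t * t ^ d) := by
      rw [Iker, ← Ioi_inter_Iic, inter_comm, ← setLIntegral_indicator measurableSet_Iic]
      refine setLIntegral_congr_fun measurableSet_Ioi fun t ht => ?_
      have ht : 0 < t := ht
      by_cases h : t ∈ Iic η
      · simp only [indicator_of_mem h]
        rw [ENNReal.ofReal_mul' (by positivity)]
      · simp only [indicator_of_notMem h, zero_mul]
    rw [h1, ← Ioc_union_Ioc_eq_Ioc hr.le hη.le, lintegral_union measurableSet_Ioc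
      (Ioc_disjoint_Ioc_of_le le_rfl)]
    congr 1
    · refine setLIntegral_congr_fun measurableSet_Ioc fun t ht => ?_
      simp only [_root_.ker, if_pos ht.2]
    · refine setLIntegral_congr_fun measurableSet_Ioc fun t ht => ?_
      simp only [_root_.ker, if_neg (not_le.2 ht.1)]
      have ht : 0 < t := hr.trans ht.1
      rw [← Real.rpow_natCast, ← Real.rpow_add ht]
      congr 2; ring
  have e1 : (∫⁻ t in Ioc 0 r, ENNReal.ofReal (r ^ (-((d:ℝ) + s)) * t ^ d)) =
      ENNReal.ofReal (r ^ (1 - s) / (d + 1)) := by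
    rw [← ofReal_integral_eq_lintegral_ofReal]
    · congr 1
      rw [integral_const_mul, ← intervalIntegral.integral_of_le hr.le, integral_pow]
      have : r ^ (1 - s) = r ^ (-((d:ℝ) + s)) * r ^ (d + 1) := by
        rw [← Real.rpow_natCast, ← Real.rpow_add hr]; congr 1; push_cast; ring
      rw [this]; simp; ring
    · exact (Continuous.integrableOn_Icc (by fun_prop)).mono_set Ioc_subset_Icc_self
    · filter_upwards [self_mem_ae_restrict measurableSet_Ioc] with t ht
      have := ht.1
      simp only [Pi.zero_apply]; positivity
  have e2 : (∫⁻ t in Ioc r η, ENNReal.ofReal (t ^ (-s))) =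
      ENNReal.ofReal (∫ t in r..η, t ^ (-s)) := by
    rw [intervalIntegral.integral_of_le hη.le, ← ofReal_integral_eq_lintegral_ofReal]
    · refine (ContinuousOn.integrableOn_Icc ?_).mono_set Ioc_subset_Icc_self
      intro t ht
      exact (Real.continuousAt_rpow_const _ _ (Or.inl (hr.trans_le ht.1).ne')).continuousWithinAt
    · filter_upwards [self_mem_ae_restrict measurableSet_Ioc] with t ht
      have := hr.trans ht.1
      simp only [Pi.zero_apply]; positivity
  have hnn : 0 ≤ ∫ t in r..η, t ^ (-s) := by
    apply intervalIntegral.integral_nonneg hη.le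
    intro t ht
    have := hr.trans_le ht.1
    positivity
  have h0 : (0:ℝ) ∉ uIcc r η := by
    rw [uIcc_of_le hη.le]; exact fun h => absurd h.1 (not_le.2 hr)
  rw [hsplit, e1, e2, ← ENNReal.ofReal_add (by positivity) hnn]
  congr 1
  by_cases h : s = 1
  · subst h
    simp only [sgm, cst, if_true, sub_self, Real.rpow_zero, Real.rpow_neg_one]
    rw [integral_inv h0, Real.log_div hη0.ne' hr.ne', abs_of_neg (Real.log_neg hr hr1)]
    ring
  · simp only [sgm, cst, if_neg h]
    rw [integral_rpow (Or.inr ⟨by intro h'; apply h; linarith, h0⟩)]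
    have : -s + 1 = 1 - s := by ring
    rw [this]
    have h1 : s - 1 ≠ 0 := sub_ne_zero.2 h
    have h2 : 1 - s ≠ 0 := sub_ne_zero.2 (Ne.symm h)
    have h3 : (1 - s) = -(s - 1) := by ring
    rw [show (η ^ (1 - s) - r ^ (1 - s)) / (1 - s) = -(η ^ (1 - s) - r ^ (1 - s)) / (s - 1) by
      rw [show (1 - s) = -(s - 1) by ring]; rw [div_neg, neg_div]]
    field_simp
    ring

lemma sgm_tendsto (d : ℕ) (s : ℝ) (hs : 1 ≤ s) :
    Tendsto (sgm d s) (nhdsWithin 0 (Ioi 0)) atTop := by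
  by_cases h : s = 1
  · have : sgm d s = fun r => |Real.log r| := by ext r; simp [sgm, h]
    rw [this]
    exact tendsto_abs_atBot_atTop.comp Real.tendsto_log_nhdsGT_zero
  · have h1 : 1 < s := lt_of_le_of_ne hs (Ne.symm h)
    have : sgm d s = fun r => ((((d : ℝ) + s) / ((d : ℝ) + 1)) / (s - 1)) * r ^ (1 - s) := by
      ext r; simp [sgm, h]; ring
    rw [this]
    apply Tendsto.const_mul_atTop
    · have : 0 < s - 1 := by linarith
      positivity
    · exact tendsto_rpow_neg_nhdsGT_zero (by linarith)

lemma Iker_div (d : ℕ) (s η : ℝ) (hs : 1 ≤ s) (hη : 0 < η) :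
    Tendsto (fun r => Iker d s η r / ENNReal.ofReal (sgm d s r)) (nhdsWithin 0 (Ioi 0)) (nhds 1) := by
  have hT := sgm_tendsto d s hs
  have h1 : Tendsto (fun r => 1 + cst d s η / sgm d s r) (nhdsWithin 0 (Ioi 0)) (nhds (1 + 0)) :=
    tendsto_const_nhds.add (hT.const_div_atTop _)
  have h2 := ENNReal.tendsto_ofReal h1
  rw [add_zero, ENNReal.ofReal_one] at h2
  refine h2.congr' ?_
  filter_upwards [self_mem_nhdsWithin, hT.eventually_gt_atTop 0,
    Ioo_mem_nhdsGT (lt_min hη one_pos)] with r hr hr1 hr2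
  rw [Iker_eq d s η r hs hr (hr2.2.trans_le (min_le_right _ _)) (hr2.2.trans_le (min_le_left _ _)),
    ← ENNReal.ofReal_div_of_pos hr1]
  congr 1
  field_simp

/-- total variation of translation differences -/
def V {d : ℕ} (f : Euc d → ℝ) (h : Euc d) : ℝ≥0∞ := ∫⁻ x, ‖f (x + h) - f x‖ₑ

lemma V_meas {d : ℕ} {f : Euc d → ℝ} (hf : Measurable f) : Measurable (V f) := by
  unfold V
  apply Measurable.lintegral_prod_right' (f := fun p : Euc d × Euc d => ‖f (p.2 + p.1) - f p.2‖ₑ)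
  fun_prop

def chi {d : ℕ} (E : Set (Euc d)) : Euc d → ℝ := E.indicator (fun _ => 1)

lemma chi_meas {d : ℕ} {E : Set (Euc d)} (hE : MeasurableSet E) : Measurable (chi E) :=
  measurable_const.indicator hE

lemma V_chi_le {d : ℕ} {E : Set (Euc d)} (hE : MeasurableSet E) (h : Euc d) :
    V (chi E) h ≤ 2 * volume E := by
  have hm := chi_meas hE
  have e : ∫⁻ x, ‖chi E x‖ₑ = volume E := by
    rw [← lintegral_indicator_one hE]
    refine lintegral_congr fun x => ?_
    by_cases hx : x ∈ E <;> simp [chi, hx]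
  calc V (chi E) h ≤ ∫⁻ x, (‖chi E (x + h)‖ₑ + ‖chi E x‖ₑ) := lintegral_mono fun x => enorm_sub_le
    _ = (∫⁻ x, ‖chi E (x + h)‖ₑ) + ∫⁻ x, ‖chi E x‖ₑ := lintegral_add_left (by fun_prop) _
    _ = _ := by rw [lintegral_add_right_eq_self (fun x => ‖chi E x‖ₑ), e, two_mul]

lemma Jt_eq {d : ℕ} (s r : ℝ) {E : Set (Euc d)} (hE : MeasurableSet E) :
    2 * Jt d s r E = ∫⁻ h : Euc d, ENNReal.ofReal (ker d s r ‖h‖) * V (chi E) h := by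
  have hk := ker_meas d s r
  have hm := chi_meas hE
  have e1 : ∫⁻ h : Euc d, ENNReal.ofReal (ker d s r ‖h‖) * V (chi E) h =
      ∫⁻ x : Euc d, ∫⁻ y, ENNReal.ofReal (ker d s r (dist x y)) * ‖chi E y - chi E x‖ₑ := by
    unfold V
    have hc : ∀ h : Euc d, ENNReal.ofReal (_root_.ker d s r ‖h‖) * ∫⁻ x, ‖chi E (x + h) - chi E x‖ₑ =
        ∫⁻ x, ENNReal.ofReal (_root_.ker d s r ‖h‖) * ‖chi E (x + h) - chi E x‖ₑ := fun h =>
      (lintegral_const_mul _ (by fun_prop)).symm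
    simp_rw [hc]
    rw [lintegral_lintegral_swap (by fun_prop)]
    refine lintegral_congr fun x => ?_
    rw [← lintegral_add_left_eq_self (fun y => ENNReal.ofReal (_root_.ker d s r (dist x y)) *
      ‖chi E y - chi E x‖ₑ) x]
    simp
  have hJ2 : Jt d s r E = ∫⁻ x in Eᶜ, ∫⁻ y in E, ENNReal.ofReal (ker d s r (dist x y)) := by
    rw [Jt, lintegral_lintegral_swap (by fun_prop)]
    simp_rw [dist_comm]
  rw [e1, ← lintegral_add_compl _ hE, two_mul]
  congr 1
  · refine setLIntegral_congr_fun hE fun x hx => ?_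
    rw [← lintegral_indicator hE.compl]
    refine lintegral_congr fun y => ?_
    by_cases hy : y ∈ E <;> simp [chi, hx, hy]
  · rw [hJ2]
    refine setLIntegral_congr_fun hE.compl fun x hx => ?_
    rw [← lintegral_indicator hE]
    have hx : x ∉ E := hx
    refine lintegral_congr fun y => ?_
    by_cases hy : y ∈ E <;> simp [chi, hx, hy]

lemma tail (d : ℕ) (s : ℝ) (hs : 1 ≤ s) : ∃ T : ℝ≥0∞, T < ∞ ∧ ∀ r, 0 < r → r < 1 →
    ∫⁻ h in (closedBall (0 : Euc d) 1)ᶜ, ENNReal.ofReal (ker d s r ‖h‖) ≤ T := by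
  refine ⟨ENNReal.ofReal (2 ^ ((d:ℝ) + s)) * ∫⁻ h : Euc d, ENNReal.ofReal ((1 + ‖h‖) ^ (-((d:ℝ) + s))),
    ENNReal.mul_lt_top ENNReal.ofReal_lt_top (finite_integral_one_add_norm ?_), fun r hr hr1 => ?_⟩
  · simp; linarith
  · rw [← lintegral_const_mul _ (by fun_prop)]
    refine le_trans ?_ (setLIntegral_le_lintegral (closedBall (0 : Euc d) 1)ᶜ _)
    refine setLIntegral_mono' measurableSet_closedBall.compl fun h hh => ?_
    have hh : 1 < ‖h‖ := by simpa using hh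
    rw [← ENNReal.ofReal_mul (by positivity)]
    apply ENNReal.ofReal_le_ofReal
    rw [_root_.ker, if_neg (by linarith), Real.rpow_neg (by positivity), Real.rpow_neg (by positivity),
      ← div_eq_mul_inv, inv_eq_one_div, div_le_div_iff₀ (by positivity) (by positivity), one_mul,
      ← Real.mul_rpow (by positivity) (by positivity)]
    apply Real.rpow_le_rpow (by positivity) (by linarith) (by positivity)

/-- gradient -/
def grd {d : ℕ} (u : Euc d → ℝ) (x : Euc d) : Euc d :=
  (InnerProductSpace.toDual ℝ (Euc d)).symm (fderiv ℝ u x)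

lemma grd_inner {d : ℕ} (u : Euc d → ℝ) (x h : Euc d) :
    (inner ℝ (grd u x) h : ℝ) = fderiv ℝ u x h := by
  simp [grd]

lemma grd_cont {d : ℕ} {u : Euc d → ℝ} (hu : ContDiff ℝ 1 u) : Continuous (grd u) := by
  unfold grd
  have := hu.continuous_fderiv one_ne_zero
  fun_prop

def TV {d : ℕ} (u : Euc d → ℝ) : ℝ≥0∞ := ∫⁻ x, ‖grd u x‖ₑ

lemma V_le {d : ℕ} {u : Euc d → ℝ} (hu : ContDiff ℝ 1 u) (h : Euc d) :
    V u h ≤ ∫⁻ x, ‖(inner ℝ (grd u x) h : ℝ)‖ₑ := by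
  have hc := grd_cont hu
  have key : ∀ x, ‖u (x + h) - u x‖ₑ ≤ ∫⁻ t in Ioc (0:ℝ) 1, ‖(inner ℝ (grd u (x + t • h)) h : ℝ)‖ₑ := by
    intro x
    have hd : ∀ t ∈ uIcc (0:ℝ) 1, HasDerivAt (fun t : ℝ => u (x + t • h))
        (inner ℝ (grd u (x + t • h)) h : ℝ) t := by
      intro t _
      rw [grd_inner]
      have h1 := (hu.differentiable one_ne_zero (x + t • h)).hasFDerivAt
      have h2 : HasDerivAt (fun t : ℝ => x + t • h) h t := by
        simpa using ((hasDerivAt_id t).smul_const h).const_add x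
      exact h1.comp_hasDerivAt t h2
    have := intervalIntegral.integral_eq_sub_of_hasDerivAt hd
      (Continuous.intervalIntegrable (by fun_prop) _ _)
    simp only [one_smul, zero_smul, add_zero] at this
    rw [← this, intervalIntegral.integral_of_le zero_le_one]
    exact enorm_integral_le_lintegral_enorm _
  calc V u h ≤ ∫⁻ x, ∫⁻ t in Ioc (0:ℝ) 1, ‖(inner ℝ (grd u (x + t • h)) h : ℝ)‖ₑ := lintegral_mono key
    _ = ∫⁻ t in Ioc (0:ℝ) 1, ∫⁻ x, ‖(inner ℝ (grd u (x + t • h)) h : ℝ)‖ₑ := by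
        rw [lintegral_lintegral_swap]
        apply Measurable.aemeasurable
        apply Continuous.measurable
        fun_prop
    _ = ∫⁻ t in Ioc (0:ℝ) 1, ∫⁻ x, ‖(inner ℝ (grd u x) h : ℝ)‖ₑ := by
        refine lintegral_congr fun t => ?_
        exact lintegral_add_right_eq_self (fun x => ‖(inner ℝ (grd u x) h : ℝ)‖ₑ) (t • h)
    _ = _ := by simp

lemma TV_radial {d : ℕ} (hd : 2 ≤ d) {u : Euc d → ℝ} (hu : ContDiff ℝ 1 u) (f : ℝ → ℝ≥0∞)
    (hf : Measurable f) :
    ∫⁻ h : Euc d, f ‖h‖ * ∫⁻ x, ‖(inner ℝ (grd u x) h : ℝ)‖ₑ =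
      TV u * (ENNReal.ofReal (2 * omegaB (d - 1)) * ∫⁻ t in Ioi (0:ℝ), f t * ENNReal.ofReal (t ^ d)) := by
  have hc := grd_cont hu
  have hc' : Measurable (grd u) := hc.measurable
  have e : ∀ h : Euc d, f ‖h‖ * ∫⁻ x, ‖(inner ℝ (grd u x) h : ℝ)‖ₑ =
      ∫⁻ x, f ‖h‖ * ‖(inner ℝ (grd u x) h : ℝ)‖ₑ := fun h => 
    (lintegral_const_mul _ (by fun_prop)).symm
  simp_rw [e]
  rw [lintegral_lintegral_swap (by fun_prop)]
  simp_rw [radial_inner hd _ f hf, mul_assoc]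
  rw [lintegral_mul_const _ (by fun_prop), TV]

lemma pointwise_lower {d : ℕ} (hd : 2 ≤ d) (s : ℝ) (hs : 1 ≤ s) {u : Euc d → ℝ} (hu : ContDiff ℝ 1 u)
    (x : Euc d) :
    ‖grd u x‖ₑ * ENNReal.ofReal (2 * omegaB (d - 1)) ≤
      liminf (fun r => (∫⁻ h : Euc d, ENNReal.ofReal (_root_.ker d s r ‖h‖) * ‖u (x + h) - u x‖ₑ) /
        ENNReal.ofReal (sgm d s r)) (nhdsWithin 0 (Ioi 0)) := by
  set S := (volume : Measure (Euc d)).toSphere univ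
  have hS : S ≠ ∞ := measure_ne_top _ _
  set A := ENNReal.ofReal (2 * omegaB (d - 1))
  set L := liminf (fun r => (∫⁻ h : Euc d, ENNReal.ofReal (_root_.ker d s r ‖h‖) * ‖u (x + h) - u x‖ₑ) /
        ENNReal.ofReal (sgm d s r)) (nhdsWithin 0 (Ioi 0)) with hL
  have hum : Measurable u := hu.continuous.measurable
  have main : ∀ δ : ℝ, 0 < δ → ‖grd u x‖ₑ * A ≤ L + ENNReal.ofReal δ * S := by
    intro δ hδ
    have hdiff := (hu.differentiable one_ne_zero x).hasFDerivAt
    rw [hasFDerivAt_iff_isLittleO_nhds_zero] at hdiff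
    have h1 := hdiff.bound hδ
    obtain ⟨η, hη, hη'⟩ := Metric.nhds_basis_closedBall.eventually_iff.1 h1
    have ineq : ∀ r, ‖grd u x‖ₑ * A * Iker d s η r ≤
        (∫⁻ h : Euc d, ENNReal.ofReal (_root_.ker d s r ‖h‖) * ‖u (x + h) - u x‖ₑ) +
          ENNReal.ofReal δ * S * Iker d s η r := by
      intro r
      have hk := ker_meas d s r
      set f : ℝ → ℝ≥0∞ := (Iic η).indicator (fun t => ENNReal.ofReal (_root_.ker d s r t)) with hf
      have hfm : Measurable f := Measurable.indicator (by fun_prop) measurableSet_Iic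
      have r1 := radial_inner hd (grd u x) f hfm
      have r2 := radial_norm hd f hfm
      change _ = _ * Iker d s η r at r1
      change _ = _ * Iker d s η r at r2
      rw [← r1, mul_assoc, ← r2, ← lintegral_const_mul _ (by fun_prop), ← lintegral_add_right _ (by fun_prop)]
      refine lintegral_mono fun h => ?_
      by_cases hh : ‖h‖ ≤ η
      · have e : f ‖h‖ = ENNReal.ofReal (_root_.ker d s r ‖h‖) := indicator_of_mem (show ‖h‖ ∈ Iic η from hh) _
        simp only [e]
        rw [mul_left_comm, ← mul_add]
        gcongr
        have h3 := hη' (show h ∈ closedBall 0 η by simpa using hh)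
        rw [grd_inner, ← ofReal_norm, ← ofReal_norm, ← ofReal_norm, ← ENNReal.ofReal_mul hδ.le,
          ← ENNReal.ofReal_add (norm_nonneg _) (by positivity)]
        apply ENNReal.ofReal_le_ofReal
        have h4 := norm_sub_norm_le (fderiv ℝ u x h) (u (x + h) - u x)
        rw [norm_sub_rev (fderiv ℝ u x h)] at h4
        linarith
      · have e : f ‖h‖ = 0 := indicator_of_notMem (show ‖h‖ ∉ Iic η from hh) _
        simp [e]
    have hI := Iker_div d s η hs hη
    have t1 : Tendsto (fun r => ‖grd u x‖ₑ * A * (Iker d s η r / ENNReal.ofReal (sgm d s r)) -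
        ENNReal.ofReal δ * S * (Iker d s η r / ENNReal.ofReal (sgm d s r))) (nhdsWithin 0 (Ioi 0))
        (nhds (‖grd u x‖ₑ * A * 1 - ENNReal.ofReal δ * S * 1)) := by
      apply ENNReal.Tendsto.sub
      · exact ENNReal.Tendsto.const_mul hI (Or.inl one_ne_zero)
      · exact ENNReal.Tendsto.const_mul hI (Or.inl one_ne_zero)
      · left; rw [mul_one]; exact ENNReal.mul_ne_top enorm_ne_top ENNReal.ofReal_ne_top
    rw [← tsub_le_iff_right]
    rw [mul_one, mul_one] at t1
    rw [← t1.liminf_eq, hL]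
    refine liminf_le_liminf (Eventually.of_forall fun r => ?_)
    rw [tsub_le_iff_right, ← mul_div_assoc, ← mul_div_assoc, ENNReal.div_add_div_same]
    exact ENNReal.div_le_div_right (ineq r) _
  have t : Tendsto (fun δ : ℝ => L + ENNReal.ofReal δ * S) (nhdsWithin 0 (Ioi 0)) (nhds (L + 0 * S)) := by
    apply Tendsto.const_add
    apply ENNReal.Tendsto.mul_const _ (Or.inr hS)
    have := ENNReal.tendsto_ofReal (tendsto_id (α := ℝ) (x := nhds 0))
    rw [ENNReal.ofReal_zero] at this
    exact this.mono_left nhdsWithin_le_nhds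
  rw [zero_mul, add_zero] at t
  refine ge_of_tendsto t ?_
  filter_upwards [self_mem_nhdsWithin] with δ hδ using main δ hδ

lemma smooth_lower {d : ℕ} (hd : 2 ≤ d) (s : ℝ) (hs : 1 ≤ s) {u : Euc d → ℝ} (hu : ContDiff ℝ 1 u) :
    TV u * ENNReal.ofReal (2 * omegaB (d - 1)) ≤
      liminf (fun r => (∫⁻ h : Euc d, ENNReal.ofReal (_root_.ker d s r ‖h‖) * V u h) /
        ENNReal.ofReal (sgm d s r)) (nhdsWithin 0 (Ioi 0)) := by
  have hum : Measurable u := hu.continuous.measurable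
  have hgm : Measurable (grd u) := (grd_cont hu).measurable
  have e : ∀ r, (∫⁻ h : Euc d, ENNReal.ofReal (_root_.ker d s r ‖h‖) * V u h) /
        ENNReal.ofReal (sgm d s r) = ∫⁻ x, (∫⁻ h : Euc d, ENNReal.ofReal (_root_.ker d s r ‖h‖) * ‖u (x + h) - u x‖ₑ) /
        ENNReal.ofReal (sgm d s r) := by
    intro r
    have hk := ker_meas d s r
    have e' : ∀ h : Euc d, ENNReal.ofReal (_root_.ker d s r ‖h‖) * V u h =
      ∫⁻ x, ENNReal.ofReal (_root_.ker d s r ‖h‖) * ‖u (x + h) - u x‖ₑ := fun h => 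
        (lintegral_const_mul _ (by fun_prop)).symm
    simp_rw [e', div_eq_mul_inv]
    rw [lintegral_lintegral_swap (by fun_prop), lintegral_mul_const]
    apply Measurable.lintegral_prod_right' (f := fun p : Euc d × Euc d => 
      ENNReal.ofReal (_root_.ker d s r ‖p.2‖) * ‖u (p.1 + p.2) - u p.1‖ₑ)
    fun_prop
  simp_rw [e]
  refine le_trans ?_ (lintegral_liminf_le ?_)
  · rw [TV, ← lintegral_mul_const _ (by fun_prop)]
    exact lintegral_mono fun x => pointwise_lower hd s hs hu x
  · intro r
    have hk := ker_meas d s r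
    apply Measurable.div_const
    apply Measurable.lintegral_prod_right' (f := fun p : Euc d × Euc d => 
      ENNReal.ofReal (_root_.ker d s r ‖p.2‖) * ‖u (p.1 + p.2) - u p.1‖ₑ)
    fun_prop

open scoped Convolution

def mol {d : ℕ} (φ : ContDiffBump (0 : Euc d)) (E : Set (Euc d)) : Euc d → ℝ :=
  (φ.normed volume) ⋆[ContinuousLinearMap.lsmul ℝ ℝ, volume] (chi E)

lemma mol_apply {d : ℕ} (φ : ContDiffBump (0 : Euc d)) (E : Set (Euc d)) (x : Euc d) :
    mol φ E x = ∫ z, φ.normed volume z * chi E (x - z) := by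
  simp [mol, convolution]

lemma chi_norm_le {d : ℕ} (E : Set (Euc d)) (x : Euc d) : ‖chi E x‖ ≤ 1 := by
  by_cases h : x ∈ E <;> simp [chi, h]

lemma chi_locInt {d : ℕ} {E : Set (Euc d)} (hE : MeasurableSet E) : LocallyIntegrable (chi E) := by
  refine (locallyIntegrable_const (1:ℝ)).mono (chi_meas hE).aestronglyMeasurable (ae_of_all _ fun x => ?_)
  simpa using chi_norm_le E x

lemma mol_contDiff {d : ℕ} (φ : ContDiffBump (0 : Euc d)) {E : Set (Euc d)} (hE : MeasurableSet E) :
    ContDiff ℝ 2 (mol φ E) :=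
  φ.hasCompactSupport_normed.contDiff_convolution_left _ φ.contDiff_normed (chi_locInt hE)

lemma rho_int {d : ℕ} (φ : ContDiffBump (0 : Euc d)) : Integrable (φ.normed (volume : Measure (Euc d))) :=
  φ.integrable_normed

lemma rho_chi_int {d : ℕ} (φ : ContDiffBump (0 : Euc d)) {E : Set (Euc d)} (hE : MeasurableSet E) (x : Euc d) :
    Integrable (fun z => φ.normed volume z * chi E (x - z)) := by
  have hm := chi_meas hE
  refine (rho_int φ).mono (((rho_int φ).aestronglyMeasurable).mul
    (Measurable.aestronglyMeasurable (by fun_prop))) (ae_of_all _ fun z => ?_)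
  rw [norm_mul]
  exact mul_le_of_le_one_right (norm_nonneg _) (chi_norm_le E _)

lemma rho_lint {d : ℕ} (φ : ContDiffBump (0 : Euc d)) : ∫⁻ z, ‖φ.normed (volume : Measure (Euc d)) z‖ₑ = 1 := by
  have h := φ.integral_normed (μ := (volume : Measure (Euc d)))
  have h2 := ofReal_integral_eq_lintegral_ofReal (rho_int φ) (ae_of_all _ fun x => φ.nonneg_normed x)
  rw [h, ENNReal.ofReal_one] at h2
  rw [h2]
  refine lintegral_congr fun z => ?_
  rw [← ofReal_norm, Real.norm_of_nonneg (φ.nonneg_normed z)]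

lemma rho_meas {d : ℕ} (φ : ContDiffBump (0 : Euc d)) : Measurable (φ.normed (volume : Measure (Euc d))) :=
  φ.continuous_normed.measurable

lemma mol_enorm_le {d : ℕ} (φ : ContDiffBump (0 : Euc d)) {E : Set (Euc d)}  (x : Euc d) :
    ‖mol φ E x‖ₑ ≤ 1 := by
  rw [mol_apply, ← rho_lint φ]
  refine (enorm_integral_le_lintegral_enorm _).trans (lintegral_mono fun z => ?_)
  rw [enorm_mul]
  refine mul_le_of_le_one_right' ?_
  rw [← ofReal_norm, ← ENNReal.ofReal_one]
  exact ENNReal.ofReal_le_ofReal (chi_norm_le _ _)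

lemma mol_norm_le {d : ℕ} (φ : ContDiffBump (0 : Euc d)) {E : Set (Euc d)}  (x : Euc d) :
    ‖mol φ E x‖ ≤ 1 := by
  have := mol_enorm_le φ (E := E) x
  rw [← ofReal_norm, ← ENNReal.ofReal_one, ENNReal.ofReal_le_ofReal_iff zero_le_one] at this
  exact this

lemma V_mol_le {d : ℕ} (φ : ContDiffBump (0 : Euc d)) {E : Set (Euc d)} (hE : MeasurableSet E) (h : Euc d) :
    V (mol φ E) h ≤ V (chi E) h := by
  have hm := chi_meas hE
  have hr := rho_meas φ
  calc V (mol φ E) h ≤ ∫⁻ x, ∫⁻ z, ‖φ.normed volume z‖ₑ * ‖chi E (x - z + h) - chi E (x - z)‖ₑ := by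
        refine lintegral_mono fun x => ?_
        rw [mol_apply, mol_apply, ← integral_sub (rho_chi_int φ hE _) (rho_chi_int φ hE _)]
        refine (enorm_integral_le_lintegral_enorm _).trans (lintegral_mono fun z => ?_)
        rw [← mul_sub, enorm_mul, add_sub_right_comm]
    _ = ∫⁻ z, ∫⁻ x, ‖φ.normed volume z‖ₑ * ‖chi E (x - z + h) - chi E (x - z)‖ₑ := by
        rw [lintegral_lintegral_swap (by fun_prop)]
    _ = ∫⁻ z, ‖φ.normed volume z‖ₑ * V (chi E) h := by
        refine lintegral_congr fun z => ?_
        rw [lintegral_const_mul _ (by fun_prop), V,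
          lintegral_sub_right_eq_self (fun x => ‖chi E (x + h) - chi E x‖ₑ) z]
    _ = V (chi E) h := by
        rw [lintegral_mul_const _ (by fun_prop), rho_lint, one_mul]

section div
variable {d : ℕ} {Φ : Euc d → Euc d}

lemma diverg_cont (hΦ : ContDiff ℝ 1 Φ) : Continuous (diverg Φ) := by
  unfold diverg
  have := hΦ.continuous_fderiv one_ne_zero
  fun_prop

lemma diverg_supp (hs : HasCompactSupport Φ) : HasCompactSupport (diverg Φ) := by
  refine (hs.fderiv ℝ).mono' ?_
  intro x hx
  apply subset_tsupport
  intro h0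
  apply hx
  simp [diverg, h0]

lemma diverg_int (hΦ : ContDiff ℝ 1 Φ) (hs : HasCompactSupport Φ) : Integrable (diverg Φ) :=
  (diverg_cont hΦ).integrable_of_hasCompactSupport (diverg_supp hs)

lemma diverg_shift (z : Euc d) (x : Euc d) : diverg (fun y => Φ (y + z)) x = diverg Φ (x + z) := by
  simp only [diverg, fderiv_comp_add_right]

lemma ibp {u : Euc d → ℝ} (hu : ContDiff ℝ 1 u) (hΦ : ContDiff ℝ 1 Φ) (hs : HasCompactSupport Φ) :
    ∫ x, u x * diverg Φ x = - ∫ x, (inner ℝ (grd u x) (Φ x) : ℝ) := by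
  have hcu := hu.continuous
  have hcΦ := hΦ.continuous
  have hdu := hu.continuous_fderiv one_ne_zero
  have hdΦ := hΦ.continuous_fderiv one_ne_zero
  have hgi : ∀ i : Fin d, ContDiff ℝ 1 (fun x => Φ x i) := fun i => by fun_prop
  have hfd : ∀ (i : Fin d) x v, fderiv ℝ (fun x => Φ x i) x v = fderiv ℝ Φ x v i := by
    intro i x v
    have h1 := (hΦ.differentiable one_ne_zero x).hasFDerivAt
    have h2 := ((EuclideanSpace.proj i : Euc d →L[ℝ] ℝ).hasFDerivAt (x := Φ x)).comp x h1
    have h3 : fderiv ℝ (fun x => Φ x i) x = _ := h2.fderiv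
    rw [h3]; simp
  have hsi : ∀ i : Fin d, HasCompactSupport (fun x => Φ x i) := fun i =>
    hs.comp_left (g := fun y : Euc d => y i) rfl
  have I1 : ∀ i : Fin d, Integrable (fun x => u x * fderiv ℝ (fun x => Φ x i) x (EuclideanSpace.single i 1)) := by
    intro i
    apply Continuous.integrable_of_hasCompactSupport
    · simp_rw [hfd]; fun_prop
    · apply HasCompactSupport.mul_left
      exact (hsi i).fderiv_apply ℝ _
  have I2 : ∀ i : Fin d, Integrable (fun x => fderiv ℝ u x (EuclideanSpace.single i 1) * Φ x i) := by
    intro i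
    apply Continuous.integrable_of_hasCompactSupport
    · fun_prop
    · exact HasCompactSupport.mul_left (hsi i)
  have I3 : ∀ i : Fin d, Integrable (fun x => u x * Φ x i) := by
    intro i
    apply Continuous.integrable_of_hasCompactSupport
    · fun_prop
    · exact HasCompactSupport.mul_left (hsi i)
  have e1 : ∀ x, u x * diverg Φ x = ∑ i, u x * fderiv ℝ (fun x => Φ x i) x (EuclideanSpace.single i 1) := by
    intro x
    simp only [diverg, Finset.mul_sum, hfd]
  have e2 : ∀ x, (inner ℝ (grd u x) (Φ x) : ℝ) = ∑ i, fderiv ℝ u x (EuclideanSpace.single i 1) * Φ x i := by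
    intro x
    simp only [← grd_inner, EuclideanSpace.inner_single_right, PiLp.inner_apply]
    simp [mul_comm]
  simp_rw [e1, e2]
  rw [integral_finsetSum _ fun i _ => I1 i, integral_finsetSum _ fun i _ => I2 i, ← Finset.sum_neg_distrib]
  refine Finset.sum_congr rfl fun i _ => ?_
  exact integral_mul_fderiv_eq_neg_fderiv_mul_of_integrable (I2 i) (I1 i) (I3 i)
    (fun x _ => hu.differentiable one_ne_zero x) (fun x _ => (hgi i).differentiable one_ne_zero x)

lemma le_Per {E : Set (Euc d)} (hP : Per d E < ⊤) (hΦ : ContDiff ℝ 1 Φ) (hs : HasCompactSupport Φ)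
    (h1 : ∀ x, ‖Φ x‖ ≤ 1) : ∫ x in E, diverg Φ x ≤ (Per d E).toReal := by
  rw [← ENNReal.ofReal_le_iff_le_toReal hP.ne]
  exact le_iSup₂_of_le Φ hΦ (le_iSup₂_of_le hs h1 le_rfl)

lemma chi_mul_int {E : Set (Euc d)} (hE : MeasurableSet E) (f : Euc d → ℝ) :
    ∫ x, chi E x * f x = ∫ x in E, f x := by
  rw [← integral_indicator hE]
  congr 1; ext x
  by_cases h : x ∈ E <;> simp [chi, h]

lemma mol_div_le (φ : ContDiffBump (0 : Euc d)) {E : Set (Euc d)} (hE : MeasurableSet E)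
    (hP : Per d E < ⊤) (hΦ : ContDiff ℝ 1 Φ) (hs : HasCompactSupport Φ) (h1 : ∀ x, ‖Φ x‖ ≤ 1) :
    ∫ x, mol φ E x * diverg Φ x ≤ (Per d E).toReal := by
  have hm := chi_meas hE
  have hr := rho_meas φ
  have hD := (diverg_cont hΦ).measurable
  have hI : Integrable (fun p : Euc d × Euc d => φ.normed volume p.2 * chi E (p.1 - p.2) * diverg Φ p.1)
      (volume.prod volume) := by
    have h0 := (diverg_int hΦ hs).mul_prod (rho_int φ)
    refine h0.mono (Measurable.aestronglyMeasurable (by fun_prop)) (ae_of_all _ fun p => ?_)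
    rw [norm_mul, norm_mul, norm_mul, mul_comm]
    gcongr
    exact mul_le_of_le_one_right (norm_nonneg _) (chi_norm_le E _)
  have e1 : ∫ x, mol φ E x * diverg Φ x =
      ∫ z, ∫ x, φ.normed volume z * chi E (x - z) * diverg Φ x := by
    rw [← integral_integral_swap hI]
    congr 1; ext x
    rw [mol_apply, integral_mul_const]
  have e2 : ∀ z, ∫ x, φ.normed volume z * chi E (x - z) * diverg Φ x =
      φ.normed volume z * ∫ x in E, diverg (fun y => Φ (y + z)) x := by
    intro z
    simp_rw [mul_assoc]
    rw [integral_const_mul, ← chi_mul_int hE, ← integral_add_right_eq_self _ z]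
    simp_rw [add_sub_cancel_right, diverg_shift]
  have hI2 := hI.integral_prod_right
  rw [e1]
  calc _ ≤ ∫ z, φ.normed volume z * (Per d E).toReal := by
        refine integral_mono hI2 ((rho_int φ).mul_const _) fun z => ?_
        simp only
        rw [e2 z]
        refine mul_le_mul_of_nonneg_left ?_ (φ.nonneg_normed z)
        refine le_Per hP (by fun_prop) ?_ fun x => h1 _
        exact hs.comp_homeomorph (Homeomorph.addRight z)
    _ = _ := by rw [integral_mul_const, φ.integral_normed, one_mul]

end div

lemma grd_contDiff {d : ℕ} {u : Euc d → ℝ} (hu : ContDiff ℝ 2 u) : ContDiff ℝ 1 (grd u) := by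
  unfold grd
  have : ContDiff ℝ 1 (fderiv ℝ u) := hu.fderiv_right (by norm_num)
  exact (InnerProductSpace.toDual ℝ (Euc d)).symm.toContinuousLinearEquiv.contDiff.comp this

/-- cutoff -/
def cut (d m : ℕ) : ContDiffBump (0 : Euc d) where
  rIn := m + 1
  rOut := m + 2
  rIn_pos := by positivity
  rIn_lt_rOut := by linarith

lemma TV_le_Per {d : ℕ} (φ : ContDiffBump (0 : Euc d)) {E : Set (Euc d)} (hE : MeasurableSet E)
    (hP : Per d E < ⊤) : TV (mol φ E) ≤ Per d E := by
  set u := mol φ E with hu'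
  have hu : ContDiff ℝ 2 u := mol_contDiff φ hE
  have hu1 : ContDiff ℝ 1 u := hu.of_le (by norm_num)
  have hg := grd_contDiff hu
  have hgc := hg.continuous
  let q : ℕ → Euc d → ℝ := fun m x => √(‖grd u x‖ ^ 2 + (1 / ((m:ℝ) + 1)) ^ 2)
  have hpos : ∀ (m : ℕ) x, 0 < ‖grd u x‖ ^ 2 + (1 / ((m:ℝ) + 1)) ^ 2 := fun m x =>
    add_pos_of_nonneg_of_pos (sq_nonneg _) (pow_pos (by positivity) 2)
  have hqpos : ∀ m x, 0 < q m x := fun m x => Real.sqrt_pos.2 (hpos m x)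
  have hqge : ∀ m x, ‖grd u x‖ ≤ q m x := fun m x => by
    apply Real.le_sqrt_of_sq_le
    have : 0 ≤ (1 / ((m:ℝ) + 1)) ^ 2 := by positivity
    linarith
  have hqc : ∀ m, ContDiff ℝ 1 (q m) := fun m =>
    ContDiff.sqrt ((hg.norm_sq ℝ).add contDiff_const) fun x => (hpos m x).ne'
  let F : ℕ → Euc d → ℝ := fun m x => cut d m x / q m x * ‖grd u x‖ ^ 2
  have hFc : ∀ m, Continuous (F m) := fun m =>
    (((cut d m).continuous).div (hqc m).continuous fun x => (hqpos m x).ne').mul (by fun_prop)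
  have hF0 : ∀ m x, 0 ≤ F m x := fun m x => 
    mul_nonneg (div_nonneg (cut d m).nonneg (hqpos m x).le) (by positivity)
  have hFs : ∀ m, HasCompactSupport (F m) := fun m => by
    have : HasCompactSupport (cut d m) := (cut d m).hasCompactSupport
    refine this.mono ?_
    intro x hx h0
    apply hx
    simp [F, h0]
  have hFI : ∀ m, ∫ x, F m x ≤ (Per d E).toReal := by
    intro m
    let Ψ : Euc d → Euc d := fun x => (-(cut d m x / q m x)) • grd u x
    have hΨ : ContDiff ℝ 1 Ψ :=
      ContDiff.smul (((cut d m).contDiff.div (hqc m) fun x => (hqpos m x).ne').neg) hg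
    have hΨs : HasCompactSupport Ψ := by
      have : HasCompactSupport (cut d m) := (cut d m).hasCompactSupport
      refine this.mono ?_
      intro x hx h0
      apply hx
      simp [Ψ, h0]
    have hΨ1 : ∀ x, ‖Ψ x‖ ≤ 1 := by
      intro x
      simp only [Ψ]
      rw [norm_smul, norm_neg, Real.norm_of_nonneg (div_nonneg (cut d m).nonneg (hqpos m x).le),
        div_mul_eq_mul_div, div_le_one (hqpos m x)]
      exact (mul_le_of_le_one_left (norm_nonneg _) (cut d m).le_one).trans (hqge m x)
    have h1 := mol_div_le φ hE hP hΨ hΨs hΨ1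
    rw [← hu', ibp hu1 hΨ hΨs, ← integral_neg] at h1
    refine le_trans (le_of_eq ?_) h1
    congr 1; ext x
    simp only [F, Ψ, inner_smul_right, real_inner_self_eq_norm_sq]
    ring
  have hFL : ∀ m, ∫⁻ x, ENNReal.ofReal (F m x) ≤ Per d E := by
    intro m
    rw [← ofReal_integral_eq_lintegral_ofReal ((hFc m).integrable_of_hasCompactSupport (hFs m))
      (ae_of_all _ (hF0 m)), ENNReal.ofReal_le_iff_le_toReal hP.ne]
    exact hFI m
  have hlim : ∀ x, Tendsto (fun m => ENNReal.ofReal (F m x)) atTop (nhds ‖grd u x‖ₑ) := by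
    intro x
    rw [← ofReal_norm]
    apply ENNReal.tendsto_ofReal
    by_cases h0 : grd u x = 0
    · simp [F, h0]
    have hn : 0 < ‖grd u x‖ := norm_pos_iff.2 h0
    have hq : Tendsto (fun m => q m x) atTop (nhds ‖grd u x‖) := by
      have h1 : Tendsto (fun m : ℕ => ‖grd u x‖ ^ 2 + (1 / ((m:ℝ) + 1)) ^ 2) atTop (nhds (‖grd u x‖ ^ 2 + 0 ^ 2)) :=
        tendsto_const_nhds.add (tendsto_one_div_add_atTop_nhds_zero_nat.pow 2)
      have h2 := (Real.continuous_sqrt.tendsto _).comp h1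
      have e : √(‖grd u x‖ ^ 2 + 0 ^ 2) = ‖grd u x‖ := by simp
      rw [e] at h2
      exact h2
    have hc : Tendsto (fun m => cut d m x) atTop (nhds 1) := by
      apply tendsto_const_nhds.congr'
      obtain ⟨N, hN⟩ := exists_nat_ge ‖x‖
      filter_upwards [eventually_ge_atTop N] with m hm
      symm
      apply (cut d m).one_of_mem_closedBall
      have : (N:ℝ) ≤ m := by exact_mod_cast hm
      simp only [mem_closedBall, dist_zero_right]
      change ‖x‖ ≤ (m:ℝ) + 1
      linarith
    have := (hc.div hq hn.ne').mul_const (‖grd u x‖ ^ 2)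
    have e : 1 / ‖grd u x‖ * ‖grd u x‖ ^ 2 = ‖grd u x‖ := by field_simp
    rw [e] at this
    exact this
  calc TV u = ∫⁻ x, liminf (fun m => ENNReal.ofReal (F m x)) atTop :=
        lintegral_congr fun x => (hlim x).liminf_eq.symm
    _ ≤ liminf (fun m => ∫⁻ x, ENNReal.ofReal (F m x)) atTop :=
        lintegral_liminf_le fun m => by have := (hFc m).measurable; fun_prop
    _ ≤ Per d E := liminf_le_of_frequently_le' (Eventually.frequently (Eventually.of_forall hFL))

/-- mollifier sequence -/
def phi (d m : ℕ) : ContDiffBump (0 : Euc d) where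
  rIn := 1 / ((m:ℝ) + 1)
  rOut := 2 * (1 / ((m:ℝ) + 1))
  rIn_pos := by positivity
  rIn_lt_rOut := by
    have : 0 < 1 / ((m:ℝ) + 1) := by positivity
    linarith

lemma mol_tendsto {d : ℕ} {E : Set (Euc d)} (hE : MeasurableSet E) :
    ∀ᵐ x, Tendsto (fun m => mol (phi d m) E x) atTop (nhds (chi E x)) := by
  apply ContDiffBump.ae_convolution_tendsto_right_of_locallyIntegrable (K := 2)
  · have := (tendsto_one_div_add_atTop_nhds_zero_nat (𝕜 := ℝ)).const_mul 2
    rw [mul_zero] at this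
    exact this
  · exact Eventually.of_forall fun m => le_rfl
  · exact chi_locInt hE

lemma Per_le {d : ℕ} {E : Set (Euc d)} (hE : MeasurableSet E) {B : ℝ≥0∞}
    (hB : ∀ m, TV (mol (phi d m) E) ≤ B) : Per d E ≤ B := by
  refine iSup₂_le fun Φ hΦ => iSup₂_le fun hs h1 => ?_
  have hdc := diverg_cont hΦ
  have hdi := diverg_int hΦ hs
  have t : Tendsto (fun m => ∫ x, mol (phi d m) E x * diverg Φ x) atTop
      (nhds (∫ x, chi E x * diverg Φ x)) := by
    apply tendsto_integral_of_dominated_convergence (fun x => ‖diverg Φ x‖)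
    · intro m
      exact ((mol_contDiff (phi d m) hE).continuous.mul hdc).aestronglyMeasurable
    · exact hdi.norm
    · intro m
      refine ae_of_all _ fun x => ?_
      rw [norm_mul]
      exact mul_le_of_le_one_left (norm_nonneg _) (mol_norm_le _ _)
    · filter_upwards [mol_tendsto hE] with x hx using hx.mul_const _
  rw [chi_mul_int hE] at t
  refine le_of_tendsto (ENNReal.tendsto_ofReal t) (Eventually.of_forall fun m => ?_)
  refine le_trans ?_ (hB m)
  rw [ibp ((mol_contDiff (phi d m) hE).of_le (by norm_num)) hΦ hs, ← integral_neg]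
  refine (Real.ofReal_le_enorm _).trans ((enorm_integral_le_lintegral_enorm _).trans (lintegral_mono fun x => ?_))
  rw [enorm_neg, ← ofReal_norm, ← ofReal_norm]
  apply ENNReal.ofReal_le_ofReal
  refine (norm_inner_le_norm _ _).trans (mul_le_of_le_one_right (norm_nonneg _) (h1 x))

lemma upper_ball {d : ℕ} (hd : 2 ≤ d) (s r : ℝ) {E : Set (Euc d)} (hE : MeasurableSet E)
    (hP : Per d E < ⊤) :
    ∫⁻ h in closedBall (0 : Euc d) 1, ENNReal.ofReal (_root_.ker d s r ‖h‖) * V (chi E) h ≤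
      Per d E * (ENNReal.ofReal (2 * omegaB (d - 1)) * Iker d s 1 r) := by
  have hk := ker_meas d s r
  set f : ℝ → ℝ≥0∞ := (Iic 1).indicator (fun t => ENNReal.ofReal (_root_.ker d s r t)) with hf
  have hfm : Measurable f := Measurable.indicator (by fun_prop) measurableSet_Iic
  have hu : ∀ m, ContDiff ℝ 1 (mol (phi d m) E) := fun m => (mol_contDiff (phi d m) hE).of_le (by norm_num)
  have hum : ∀ m, Measurable (mol (phi d m) E) := fun m => (hu m).continuous.measurable
  have hVm : ∀ m, Measurable (V (mol (phi d m) E)) := fun m => V_meas (hum m)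
  have hV : ∀ h, V (chi E) h ≤ liminf (fun m => V (mol (phi d m) E) h) atTop := by
    intro h
    have ae1 := mol_tendsto hE
    have ae2 : ∀ᵐ x : Euc d, Tendsto (fun m => mol (phi d m) E (x + h)) atTop (nhds (chi E (x + h))) :=
      (measurePreserving_add_right volume h).quasiMeasurePreserving.ae ae1
    calc V (chi E) h ≤ ∫⁻ x, liminf (fun m => ‖mol (phi d m) E (x + h) - mol (phi d m) E x‖ₑ) atTop := by
          refine lintegral_mono_ae ?_
          filter_upwards [ae1, ae2] with x h1 h2
          exact ((h2.sub h1).enorm).liminf_eq.ge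
      _ ≤ _ := lintegral_liminf_le fun m => by have := hum m; fun_prop
  have hb : ∀ m, ∫⁻ h : Euc d, f ‖h‖ * V (mol (phi d m) E) h ≤
      Per d E * (ENNReal.ofReal (2 * omegaB (d - 1)) * Iker d s 1 r) := by
    intro m
    calc _ ≤ ∫⁻ h : Euc d, f ‖h‖ * ∫⁻ x, ‖(inner ℝ (grd (mol (phi d m) E) x) h : ℝ)‖ₑ := by
          refine lintegral_mono fun h => ?_
          gcongr
          exact V_le (hu m) h
      _ = _ := TV_radial hd (hu m) f hfm
      _ ≤ _ := by
          gcongr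
          · exact TV_le_Per _ hE hP
          · exact le_rfl
  calc _ = ∫⁻ h : Euc d, f ‖h‖ * V (chi E) h := by
        rw [← lintegral_indicator measurableSet_closedBall]
        refine lintegral_congr fun h => ?_
        by_cases hh : ‖h‖ ≤ 1 <;> simp [hf, indicator, hh]
    _ ≤ ∫⁻ h : Euc d, liminf (fun m => f ‖h‖ * V (mol (phi d m) E) h) atTop := by
        refine lintegral_mono fun h => ?_
        have hfin : f ‖h‖ ≠ ∞ := by
          simp only [hf, indicator]; split_ifs <;> simp
        rw [ENNReal.liminf_const_mul_of_ne_top hfin]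
        gcongr
        exact hV h
    _ ≤ liminf (fun m => ∫⁻ h : Euc d, f ‖h‖ * V (mol (phi d m) E) h) atTop :=
        lintegral_liminf_le fun m => by have := hVm m; fun_prop
    _ ≤ _ := liminf_le_of_frequently_le' (Eventually.frequently (Eventually.of_forall hb))

lemma lower_main {d : ℕ} (hd : 2 ≤ d) (s : ℝ) (hs : 1 ≤ s) {E : Set (Euc d)} (hE : MeasurableSet E) :
    ENNReal.ofReal (omegaB (d - 1)) * Per d E ≤
        Filter.liminf (fun r : ℝ => Jt d s r E / ENNReal.ofReal (sgm d s r))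
          (nhdsWithin 0 (Set.Ioi 0)) := by
  set L := Filter.liminf (fun r : ℝ => Jt d s r E / ENNReal.ofReal (sgm d s r))
          (nhdsWithin 0 (Set.Ioi 0)) with hL
  have h2 : ∀ m, TV (mol (phi d m) E) * ENNReal.ofReal (2 * omegaB (d - 1)) ≤ 2 * L := by
    intro m
    refine (smooth_lower hd s hs ((mol_contDiff (phi d m) hE).of_le (by norm_num))).trans ?_
    rw [hL, ← ENNReal.liminf_const_mul_of_ne_top (by norm_num)]
    refine liminf_le_liminf (Eventually.of_forall fun r => ?_)
    rw [← mul_div_assoc, Jt_eq s r hE]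
    refine ENNReal.div_le_div_right (lintegral_mono fun h => ?_) _
    gcongr
    exact V_mol_le _ hE h
  have h3 : ∀ m, TV (mol (phi d m) E) * ENNReal.ofReal (omegaB (d - 1)) ≤ L := by
    intro m
    have := h2 m
    rw [ENNReal.ofReal_mul (by norm_num), mul_left_comm] at this
    norm_num at this
    exact (ENNReal.mul_le_mul_iff_right (by norm_num) (by norm_num)).1 this
  have hω : 0 < omegaB (d - 1) := ENNReal.toReal_pos (measure_ball_pos _ _ one_pos).ne' measure_ball_lt_top.ne
  have hω' : ENNReal.ofReal (omegaB (d - 1)) ≠ 0 := by simpa using hω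
  rw [mul_comm, ← ENNReal.le_div_iff_mul_le (Or.inl hω') (Or.inl ENNReal.ofReal_ne_top)]
  refine Per_le hE fun m => ?_
  rw [ENNReal.le_div_iff_mul_le (Or.inl hω') (Or.inl ENNReal.ofReal_ne_top)]
  exact h3 m

lemma upper_main {d : ℕ} (hd : 2 ≤ d) (s : ℝ) (hs : 1 ≤ s) {E : Set (Euc d)} (hE : MeasurableSet E)
    (hEfin : volume E < ⊤) (hP : Per d E < ⊤) :
    Filter.limsup (fun r : ℝ => Jt d s r E / ENNReal.ofReal (sgm d s r))
          (nhdsWithin 0 (Set.Ioi 0)) ≤ ENNReal.ofReal (omegaB (d - 1)) * Per d E := by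
  obtain ⟨T, hT, hT'⟩ := tail d s hs
  have hω : 0 ≤ omegaB (d - 1) := ENNReal.toReal_nonneg
  have b : ∀ r, 0 < r → r < 1 → Jt d s r E ≤
      Per d E * (ENNReal.ofReal (omegaB (d - 1)) * Iker d s 1 r) + T * volume E := by
    intro r hr hr1
    have hk := ker_meas d s r
    have : 2 * Jt d s r E ≤ 2 * (Per d E * (ENNReal.ofReal (omegaB (d - 1)) * Iker d s 1 r) + T * volume E) := by
      rw [Jt_eq s r hE, ← lintegral_add_compl _ (measurableSet_closedBall (x := (0 : Euc d)) (ε := 1)),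
        mul_add]
      refine add_le_add ?_ ?_
      · refine (upper_ball hd s r hE hP).trans (le_of_eq ?_)
        rw [ENNReal.ofReal_mul (by norm_num)]
        norm_num
        ring
      · calc _ ≤ ∫⁻ h in (closedBall (0 : Euc d) 1)ᶜ, ENNReal.ofReal (_root_.ker d s r ‖h‖) * (2 * volume E) := by
              refine lintegral_mono fun h => ?_
              gcongr
              exact V_chi_le hE h
          _ = (∫⁻ h in (closedBall (0 : Euc d) 1)ᶜ, ENNReal.ofReal (_root_.ker d s r ‖h‖)) * (2 * volume E) :=
              lintegral_mul_const _ (by fun_prop)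
          _ ≤ T * (2 * volume E) := by gcongr; exact hT' r hr hr1
          _ = _ := by ring
    exact (ENNReal.mul_le_mul_iff_right (by norm_num) (by norm_num)).1 this
  have t : Tendsto (fun r => Per d E * ENNReal.ofReal (omegaB (d - 1)) *
      (Iker d s 1 r / ENNReal.ofReal (sgm d s r)) + T * volume E / ENNReal.ofReal (sgm d s r))
      (nhdsWithin 0 (Ioi 0)) (nhds (Per d E * ENNReal.ofReal (omegaB (d - 1)) * 1 + T * volume E / ∞)) := by
    apply Tendsto.add
    · exact ENNReal.Tendsto.const_mul (Iker_div d s 1 hs one_pos) (Or.inl one_ne_zero)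
    · apply ENNReal.Tendsto.const_div
      · exact ENNReal.tendsto_ofReal_nhds_top.2 (sgm_tendsto d s hs)
      · right; exact (ENNReal.mul_lt_top hT hEfin).ne
  rw [mul_one, ENNReal.div_top, add_zero, mul_comm] at t
  rw [← t.limsup_eq]
  refine limsup_le_limsup ?_
  filter_upwards [Ioo_mem_nhdsGT (zero_lt_one (α := ℝ))] with r hr
  rw [← mul_div_assoc, ENNReal.div_add_div_same, mul_assoc, mul_left_comm]
  exact ENNReal.div_le_div_right (b r hr.1 hr.2) _

/-- For a finite-measure set `E` of finite perimeter:
`ω_{d-1}·Per(E) ≤ liminf_{r→0⁺} J̃_r^s(E)/σ^s(r) ≤ limsup_{r→0⁺} J̃_r^s(E)/σ^s(r)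
  ≤ M(s,d)·Per(E)`, with `M(1,d) = d·ω_d/2` and `M(s,d) = ω_{d-1}` for `s > 1`;
in particular for `s > 1` the limit exists and equals `ω_{d-1}·Per(E)`. -/
theorem stmt11 (d : ℕ) (hd : 2 ≤ d) (s : ℝ) (hs : 1 ≤ s)
    (E : Set (Euc d)) (hEmeas : MeasurableSet E) (hEfin : volume E < ⊤)
    (hPer : Per d E < ⊤) :
    ENNReal.ofReal (omegaB (d - 1)) * Per d E ≤
        Filter.liminf (fun r : ℝ => Jt d s r E / ENNReal.ofReal (sgm d s r))
          (nhdsWithin 0 (Set.Ioi 0)) ∧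
    Filter.liminf (fun r : ℝ => Jt d s r E / ENNReal.ofReal (sgm d s r))
          (nhdsWithin 0 (Set.Ioi 0)) ≤
        Filter.limsup (fun r : ℝ => Jt d s r E / ENNReal.ofReal (sgm d s r))
          (nhdsWithin 0 (Set.Ioi 0)) ∧
    Filter.limsup (fun r : ℝ => Jt d s r E / ENNReal.ofReal (sgm d s r))
          (nhdsWithin 0 (Set.Ioi 0)) ≤
        ENNReal.ofReal (if s = 1 then (d : ℝ) * omegaB d / 2 else omegaB (d - 1)) * Per d E ∧
    (1 < s →
      Tendsto (fun r : ℝ => Jt d s r E / ENNReal.ofReal (sgm d s r))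
        (nhdsWithin 0 (Set.Ioi 0))
        (nhds (ENNReal.ofReal (omegaB (d - 1)) * Per d E))) := by
  have hl := lower_main hd s hs hEmeas
  have hu := upper_main hd s hs hEmeas hEfin hPer
  refine ⟨hl, liminf_le_limsup, hu.trans ?_, fun _ => tendsto_of_le_liminf_of_limsup_le hl hu⟩
  gcongr
  split_ifs
  · exact omega_le hd
  · exact le_rfl

end
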